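/- Assume E/F is biquadratic, n = −ν_Λ(β) ≥ 1, and that for every z ∈ E₀^× with tr_{E₀/F}(z) = 0 one has β δ₀ z⁻¹ ∉ N_{E/E₀}(E^×). Then for every g ∈ P(Λ) and every k ∈ {−2,−1,1,2}, the function ψ_β is nontrivial on g U_k g⁻¹ ∩ P_{⌊n/2⌋+1}(Λ): there exists x in this intersection with ψ_β(x) ≠ 1. (Proposition 5.2.2.) -/

import Mathlib

/-- Encoding of a nonarchimedean local field via a (normalized, surjective)
additive valuation `ν : K → ℤ` with junk value at `0`:  `ν` is additive on
products and ultrametric on nonzero elements, `ν(K^×) = ℤ`, the field is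
complete (every `ν`-Cauchy sequence converges), and the residue field is
finite (finitely many residue classes of integers). -/
structure IsNALocalField {K : Type*} [Field K] (ν : K → ℤ) : Prop where
  map_mul : ∀ x y : K, x ≠ 0 → y ≠ 0 → ν (x * y) = ν x + ν y
  ultrametric : ∀ x y : K, x ≠ 0 → y ≠ 0 → x + y ≠ 0 → min (ν x) (ν y) ≤ ν (x + y)
  surj : ∀ n : ℤ, ∃ x : K, x ≠ 0 ∧ ν x = n
  complete : ∀ a : ℕ → K,
    (∀ N : ℤ, ∃ M : ℕ, ∀ m ≥ M, ∀ n ≥ M, a m = a n ∨ N ≤ ν (a m - a n)) →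
    ∃ L : K, ∀ N : ℤ, ∃ M : ℕ, ∀ m ≥ M, a m = L ∨ N ≤ ν (a m - L)
  finiteResidue : ∃ S : Finset K, ∀ x : K, (x = 0 ∨ 0 ≤ ν x) →
    ∃ y ∈ S, x = y ∨ 0 < ν (x - y)

/-- Odd residual characteristic: `2` is a unit of the valuation ring
(equivalently, the characteristic of the residue field is odd). -/
def OddResidualChar {K : Type*} [Field K] (ν : K → ℤ) : Prop :=
  (2 : K) ≠ 0 ∧ ν (2 : K) = 0

/-- `E/F` is biquadratic: Galois with group `ℤ/2ℤ × ℤ/2ℤ`. -/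
def IsBiquadratic (F E : Type*) [Field F] [Field E] [Algebra F E] : Prop :=
  IsGalois F E ∧ Nonempty ((E ≃ₐ[F] E) ≃* Multiplicative (ZMod 2 × ZMod 2))

/-- The index set `{−2, −1, 1, 2}` for a symplectic basis. -/
def I4 : Set ℤ := {-2, -1, 1, 2}

/-- `x` has valuation at least `m`, with the convention `ν 0 = ∞`. -/
def ValGE {K : Type*} [Field K] (ν : K → ℤ) (m : ℤ) (x : K) : Prop := x = 0 ∨ m ≤ ν x

namespace IsNALocalField

variable {K : Type*} [Field K] {ν : K → ℤ}

lemma map_one (hν : IsNALocalField ν) : ν 1 = 0 := by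
  have := hν.map_mul 1 1 one_ne_zero one_ne_zero
  rw [mul_one] at this
  omega

lemma map_neg_one (hν : IsNALocalField ν) : ν (-1) = 0 := by
  have h1 := hν.map_mul (-1) (-1) (by simp) (by simp)
  rw [neg_mul_neg, mul_one, hν.map_one] at h1
  omega

lemma map_inv (hν : IsNALocalField ν) {x : K} (hx : x ≠ 0) : ν x⁻¹ = -ν x := by
  have h1 := hν.map_mul x x⁻¹ hx (inv_ne_zero hx)
  rw [mul_inv_cancel₀ hx, hν.map_one] at h1
  omega

lemma map_pow (hν : IsNALocalField ν) {x : K} (hx : x ≠ 0) (r : ℕ) : ν (x ^ r) = r * ν x := by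
  induction r with
  | zero => simp [hν.map_one]
  | succ r ih =>
    rw [pow_succ, hν.map_mul _ _ (pow_ne_zero r hx) hx, ih]
    push_cast
    ring

lemma valGE_mono {m m' : ℤ} {x : K} (h : ValGE ν m x) (hm : m' ≤ m) : ValGE ν m' x :=
  h.imp_right hm.trans

lemma valGE_mul (hν : IsNALocalField ν) {m m' : ℤ} {x y : K} (hx : ValGE ν m x)
    (hy : ValGE ν m' y) : ValGE ν (m + m') (x * y) := by
  by_cases hx0 : x = 0
  · simp [ValGE, hx0]
  by_cases hy0 : y = 0
  · simp [ValGE, hy0]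
  have h1 := hx.resolve_left hx0
  have h2 := hy.resolve_left hy0
  right
  rw [hν.map_mul x y hx0 hy0]
  omega

lemma valGE_add (hν : IsNALocalField ν) {m : ℤ} {x y : K} (hx : ValGE ν m x)
    (hy : ValGE ν m y) : ValGE ν m (x + y) := by
  by_cases hx0 : x = 0
  · simpa [hx0] using hy
  by_cases hy0 : y = 0
  · simpa [hy0] using hx
  by_cases hxy : x + y = 0
  · exact Or.inl hxy
  exact Or.inr ((le_min (hx.resolve_left hx0) (hy.resolve_left hy0)).trans
    (hν.ultrametric x y hx0 hy0 hxy))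

lemma valGE_neg (hν : IsNALocalField ν) {m : ℤ} {x : K} (hx : ValGE ν m x) :
    ValGE ν m (-x) := by
  have := hν.valGE_mul (Or.inr hν.map_neg_one.ge : ValGE ν 0 (-1)) hx
  simpa using this

lemma valGE_sub (hν : IsNALocalField ν) {m : ℤ} {x y : K} (hx : ValGE ν m x)
    (hy : ValGE ν m y) : ValGE ν m (x - y) := by
  simpa [sub_eq_add_neg] using hν.valGE_add hx (hν.valGE_neg hy)

lemma valGE_sum (hν : IsNALocalField ν) {ι : Type*} (s : Finset ι) {m : ℤ} {f : ι → K}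
    (hf : ∀ i ∈ s, ValGE ν m (f i)) : ValGE ν m (∑ i ∈ s, f i) :=
  Finset.sum_induction f (ValGE ν m) (fun _ _ => hν.valGE_add) (Or.inl rfl) hf

lemma eq_zero_of_forall_valGE {x : K} (hx : ∀ m : ℤ, ValGE ν m x) : x = 0 := by
  rcases hx (ν x + 1) with h | h
  · exact h
  · omega

lemma not_valGE_one_of_map_eq_zero {x : K} (hx : x ≠ 0) (h0 : ν x = 0) : ¬ ValGE ν 1 x := by
  rintro (h | h)
  · exact hx h
  · omega

lemma ne_zero_of_valGE_sub_one (hν : IsNALocalField ν) {x : K} (hx : ValGE ν 1 (x - 1)) :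
    x ≠ 0 := by
  rintro rfl
  rw [zero_sub] at hx
  exact not_valGE_one_of_map_eq_zero (by simp) hν.map_neg_one hx

/-- If `x` has negative valuation, then `1 + x` does not have valuation zero. -/
lemma map_one_add_ne_zero (hν : IsNALocalField ν) {x : K} (hx : x ≠ 0) (hneg : ν x < 0) :
    ν (1 + x) ≠ 0 := by
  intro h0
  have : ValGE ν 0 (1 + x - 1) :=
    hν.valGE_sub (Or.inr h0.ge) (Or.inr hν.map_one.ge)
  rw [add_sub_cancel_left] at this
  rcases this with h | h
  · exact hx h
  · omega

/-- In odd residual characteristic every principal unit is the square of a principal unit. -/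
lemma exists_sq_eq_one_add (hν : IsNALocalField ν) (hodd : OddResidualChar ν) {a : K}
    (ha : ValGE ν 1 a) : ∃ s : K, ValGE ν 1 (s - 1) ∧ s ^ 2 = 1 + a := by
  have h2 : ValGE ν 0 (2 : K)⁻¹ := Or.inr (by rw [hν.map_inv hodd.1, hodd.2]; simp)
  let b : ℕ → K := fun i => Nat.rec 0 (fun _ x => 2⁻¹ * (a - x * x)) i
  have hsucc (i : ℕ) : b (i + 1) = 2⁻¹ * (a - b i * b i) := rfl
  have hb (i : ℕ) : ValGE ν 1 (b i) := by
    induction i with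
    | zero => exact Or.inl rfl
    | succ i ih =>
      rw [hsucc]
      have := hν.valGE_mul h2
        (hν.valGE_sub ha (valGE_mono (hν.valGE_mul ih ih) (by norm_num)))
      simpa using this
  have hdiff (i : ℕ) : ValGE ν (i + 1) (b (i + 1) - b i) := by
    induction i with
    | zero => simpa using hν.valGE_sub (hb 1) (hb 0)
    | succ i ih =>
      have h1 := hν.valGE_mul h2 (hν.valGE_mul (hν.valGE_neg ih)
        (hν.valGE_add (hb (i + 1)) (hb i)))
      have h3 : b (i + 1 + 1) - b (i + 1)
          = 2⁻¹ * (-(b (i + 1) - b i) * (b (i + 1) + b i)) := by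
        rw [hsucc (i + 1)]
        nth_rewrite 3 [hsucc i]
        ring
      rw [h3]
      refine valGE_mono h1 ?_
      push_cast
      omega
  have htail (M j : ℕ) : ValGE ν M (b (M + j) - b M) := by
    induction j with
    | zero => exact Or.inl (by simp)
    | succ j ih =>
      have := hν.valGE_add (valGE_mono (hdiff (M + j)) (by push_cast; omega)) ih
      simpa [add_assoc] using this
  have hcauchy : ∀ N : ℤ, ∃ M : ℕ, ∀ m ≥ M, ∀ n ≥ M, b m = b n ∨ N ≤ ν (b m - b n) := by
    intro N
    refine ⟨N.toNat, fun m hm n hn => ?_⟩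
    obtain ⟨i, rfl⟩ := Nat.exists_eq_add_of_le hm
    obtain ⟨j, rfl⟩ := Nat.exists_eq_add_of_le hn
    have := hν.valGE_sub (htail N.toNat i) (htail N.toNat j)
    rw [sub_sub_sub_cancel_right] at this
    exact (valGE_mono this (Int.self_le_toNat N)).imp_left sub_eq_zero.mp
  obtain ⟨L, hL⟩ := hν.complete b hcauchy
  have hlim (N : ℤ) : ∃ M : ℕ, ∀ m ≥ M, ValGE ν N (b m - L) := by
    obtain ⟨M, hM⟩ := hL N
    exact ⟨M, fun m hm => (hM m hm).imp_left sub_eq_zero.mpr⟩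
  have hL1 : ValGE ν 1 L := by
    obtain ⟨M, hM⟩ := hlim 1
    simpa using hν.valGE_sub (hb M) (hM M le_rfl)
  have hfix : L - 2⁻¹ * (a - L * L) = 0 := by
    refine eq_zero_of_forall_valGE (ν := ν) fun N => ?_
    obtain ⟨M, hM⟩ := hlim N
    have h1 := hM (M + 1) (by omega)
    have h3 := hν.valGE_mul h2
      (hν.valGE_mul (hν.valGE_neg (hM M le_rfl)) (hν.valGE_add (hb M) hL1))
    have h4 := hν.valGE_sub (valGE_mono h3 (by omega : N ≤ _)) h1
    convert h4 using 1
    rw [hsucc]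
    ring
  refine ⟨1 + L, by simpa using hL1, ?_⟩
  have h2' : (2 : K) ≠ 0 := hodd.1
  field_simp at hfix
  linear_combination hfix

/-- Principal units are infinitely `2`-divisible. -/
lemma exists_two_pow_root (hν : IsNALocalField ν) (hodd : OddResidualChar ν) (r : ℕ) :
    ∀ a : K, ValGE ν 1 (a - 1) → ∃ s : K, s ^ 2 ^ r = a := by
  induction r with
  | zero => exact fun a _ => ⟨a, by simp⟩
  | succ r ih =>
    intro a ha
    obtain ⟨s, hs, hsa⟩ := hν.exists_sq_eq_one_add hodd ha
    obtain ⟨s', rfl⟩ := ih s hs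
    exact ⟨s', by rw [pow_succ, pow_mul, hsa]; ring⟩

/-- An automorphism maps principal units to units. -/
lemma map_ringEquiv_eq_zero_of_valGE_sub_one (hν : IsNALocalField ν) (hodd : OddResidualChar ν)
    (τ : K ≃+* K) {a : K} (ha : ValGE ν 1 (a - 1)) : ν (τ a) = 0 := by
  have ha0 := hν.ne_zero_of_valGE_sub_one ha
  by_contra hne
  obtain ⟨s, hs⟩ := hν.exists_two_pow_root hodd (ν (τ a)).natAbs a ha
  have hs0 : s ≠ 0 := by
    rintro rfl
    exact ha0 (by rw [← hs, zero_pow (by positivity)])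
  have hdvd : ((2 ^ (ν (τ a)).natAbs : ℕ) : ℤ) ∣ ν (τ a) := by
    refine ⟨ν (τ s), ?_⟩
    conv_lhs => rw [← hs]
    rw [_root_.map_pow, hν.map_pow (by simpa using hs0)]
  have hle := Nat.le_of_dvd (Int.natAbs_pos.mpr hne) (Int.natCast_dvd.mp hdvd)
  exact absurd hle (not_le.mpr Nat.lt_two_pow_self)

/-- An automorphism maps elements of the maximal ideal to integral elements. -/
lemma map_ringEquiv_nonneg (hν : IsNALocalField ν) (hodd : OddResidualChar ν)
    (τ : K ≃+* K) {x : K} (hx : x ≠ 0) (hpos : 0 < ν x) : 0 ≤ ν (τ x) := by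
  have h1 : ValGE ν 1 ((1 + x) - 1) := by
    rw [add_sub_cancel_left]
    exact Or.inr hpos
  by_contra! hneg
  have hτ := hν.map_ringEquiv_eq_zero_of_valGE_sub_one hodd τ h1
  rw [map_add, _root_.map_one] at hτ
  exact hν.map_one_add_ne_zero (by simpa using hx) hneg hτ

/-- An automorphism maps units to integral elements. -/
lemma map_ringEquiv_nonneg_of_eq_zero (hν : IsNALocalField ν) (hodd : OddResidualChar ν)
    (τ : K ≃+* K) {x : K} (hx : x ≠ 0) (h0 : ν x = 0) : 0 ≤ ν (τ x) := by
  by_contra! hneg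
  obtain ⟨y, hy, hy1⟩ := hν.surj 1
  have hτx : τ x ≠ 0 := by simpa using hx
  have hτy : τ y ≠ 0 := by simpa using hy
  set N := (ν (τ y)).toNat + 1 with hN
  have hxN := pow_ne_zero N hx
  have hpos : 0 < ν (x ^ N * y) := by
    rw [hν.map_mul _ _ hxN hy, hν.map_pow hx, h0, hy1]
    simp
  have h1 := hν.map_ringEquiv_nonneg hodd τ (mul_ne_zero hxN hy) hpos
  rw [_root_.map_mul, _root_.map_pow, hν.map_mul _ _ (pow_ne_zero N hτx) hτy,
    hν.map_pow hτx] at h1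
  have h2 : ν (τ y) < N := by
    rw [hN]
    push_cast
    omega
  nlinarith

lemma map_ringEquiv_of_eq_zero (hν : IsNALocalField ν) (hodd : OddResidualChar ν)
    (τ : K ≃+* K) {x : K} (hx : x ≠ 0) (h0 : ν x = 0) : ν (τ x) = 0 := by
  have h1 := hν.map_ringEquiv_nonneg_of_eq_zero hodd τ hx h0
  have h2 := hν.map_ringEquiv_nonneg_of_eq_zero hodd τ (inv_ne_zero hx)
    (by rw [hν.map_inv hx, h0, neg_zero])
  rw [map_inv₀, hν.map_inv (by simpa using hx)] at h2
  omega

end IsNALocalField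

section Extension

variable {F E : Type*} [Field F] [Field E] [Algebra F E] {νF : F → ℤ} {νE : E → ℤ} {eEF : ℤ}

open IsNALocalField (valGE_mono not_valGE_one_of_map_eq_zero)

lemma oddResidualChar_extension
    (hcompat : ∀ t : F, t ≠ 0 → νE (algebraMap F E t) = eEF * νF t)
    (hodd : OddResidualChar νF) : OddResidualChar νE := by
  have h2 := hcompat 2 hodd.1
  rw [hodd.2, mul_zero, map_ofNat] at h2
  refine ⟨?_, h2⟩
  rw [← map_ofNat (algebraMap F E) 2]
  simpa using hodd.1

/-- The valuation of the extension is invariant under automorphisms over the base field. -/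
lemma val_algEquiv (hF : IsNALocalField νF) (hE : IsNALocalField νE)
    (heEF : 0 < eEF) (hcompat : ∀ t : F, t ≠ 0 → νE (algebraMap F E t) = eEF * νF t)
    (hodd : OddResidualChar νF) (τ : E ≃ₐ[F] E) {x : E} (hx : x ≠ 0) : νE (τ x) = νE x := by
  obtain ⟨c, hc, hcv⟩ := hF.surj (νE x)
  have hc' : algebraMap F E c ≠ 0 := by simpa using hc
  have hcE := hcompat c hc
  obtain ⟨r, rfl⟩ := Int.eq_ofNat_of_zero_le heEF.le
  have hxr := pow_ne_zero r hx
  have hτx : τ x ≠ 0 := by simpa using hx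
  have h0 : νE (x ^ r * (algebraMap F E c)⁻¹) = 0 := by
    rw [hE.map_mul _ _ hxr (inv_ne_zero hc'), hE.map_pow hx, hE.map_inv hc', hcE, hcv]
    ring
  have h1 := hE.map_ringEquiv_of_eq_zero (oddResidualChar_extension hcompat hodd)
    τ.toRingEquiv (mul_ne_zero hxr (inv_ne_zero hc')) h0
  have h2 : τ.toRingEquiv (x ^ r * (algebraMap F E c)⁻¹)
      = τ x ^ r * (algebraMap F E c)⁻¹ := by simp
  rw [h2, hE.map_mul _ _ (pow_ne_zero r hτx) (inv_ne_zero hc'), hE.map_pow hτx,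
    hE.map_inv hc', hcE, hcv] at h1
  have h3 : (r : ℤ) * (νE (τ x) - νE x) = 0 := by linear_combination h1
  rcases mul_eq_zero.mp h3 with h | h <;> omega

lemma valGE_algEquiv (hF : IsNALocalField νF) (hE : IsNALocalField νE)
    (heEF : 0 < eEF) (hcompat : ∀ t : F, t ≠ 0 → νE (algebraMap F E t) = eEF * νF t)
    (hodd : OddResidualChar νF) (τ : E ≃ₐ[F] E) {m : ℤ} {x : E} (hx : ValGE νE m x) :
    ValGE νE m (τ x) := by
  by_cases hx0 : x = 0
  · exact Or.inl (by simp [hx0])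
  · right
    rw [val_algEquiv hF hE heEF hcompat hodd τ hx0]
    exact hx.resolve_left hx0

/-- The trace of a Galois extension does not lower valuations. -/
lemma valGE_trace [FiniteDimensional F E] [IsGalois F E]
    (hF : IsNALocalField νF) (hE : IsNALocalField νE)
    (heEF : 0 < eEF) (hcompat : ∀ t : F, t ≠ 0 → νE (algebraMap F E t) = eEF * νF t)
    (hodd : OddResidualChar νF) {m : ℤ} {x : E} (hx : ValGE νE m x) :
    ValGE νE m (algebraMap F E (Algebra.trace F E x)) := by
  rw [trace_eq_sum_automorphisms]
  exact hE.valGE_sum _ fun τ _ => valGE_algEquiv hF hE heEF hcompat hodd τ hx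

/-- A principal unit fixed by an automorphism `σ` is of the form `s * σ s`. -/
lemma exists_mul_algEquiv_eq_of_valGE_sub_one (hF : IsNALocalField νF) (hE : IsNALocalField νE)
    (heEF : 0 < eEF) (hcompat : ∀ t : F, t ≠ 0 → νE (algebraMap F E t) = eEF * νF t)
    (hodd : OddResidualChar νF) (σ : E ≃ₐ[F] E) {a : E} (hσa : σ a = a)
    (ha : ValGE νE 1 (a - 1)) : ∃ s : E, s ≠ 0 ∧ s * σ s = a := by
  have hoddE := oddResidualChar_extension hcompat hodd
  obtain ⟨s, hs, hsa⟩ := hE.exists_sq_eq_one_add hoddE ha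
  rw [add_sub_cancel] at hsa
  have hsq : σ s ^ 2 = s ^ 2 := by rw [← map_pow, hsa, hσa]
  refine ⟨s, hE.ne_zero_of_valGE_sub_one hs, ?_⟩
  rcases sq_eq_sq_iff_eq_or_eq_neg.mp hsq with h | h
  · rw [h, ← hsa, sq]
  · have h1 := valGE_algEquiv hF hE heEF hcompat hodd σ hs
    rw [map_sub, map_one, h] at h1
    have h2 := hE.valGE_neg (hE.valGE_add h1 hs)
    have h3 : -(-s - 1 + (s - 1)) = 2 := by ring
    rw [h3] at h2
    exact absurd h2 (not_valGE_one_of_map_eq_zero hoddE.1 hoddE.2)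

/-- If no trace-zero `σ`-fixed element lies in the norm class of the `σ`-fixed element `y`, then
the trace of `y` has the smallest possible valuation. -/
lemma trace_ne_zero_and_val_le [FiniteDimensional F E]
    (hF : IsNALocalField νF) (hE : IsNALocalField νE)
    (heEF : 0 < eEF) (hcompat : ∀ t : F, t ≠ 0 → νE (algebraMap F E t) = eEF * νF t)
    (hodd : OddResidualChar νF) (hdim : Module.finrank F E = 4)
    (σ : E ≃ₐ[F] E) {y : E} (hy : y ≠ 0) (hσy : σ y = y)
    (hcoset : ∀ z : E, z ≠ 0 → σ z = z → Algebra.trace F E z = 0 →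
      ¬∃ w : E, w ≠ 0 ∧ y * z⁻¹ = w * σ w) :
    Algebra.trace F E y ≠ 0 ∧ eEF * νF (Algebra.trace F E y) ≤ νE y := by
  have hoddE := oddResidualChar_extension hcompat hodd
  by_contra hcon
  have hT : ValGE νE (νE y + 1) (algebraMap F E (Algebra.trace F E y)) := by
    by_cases h0 : Algebra.trace F E y = 0
    · exact Or.inl (by simp [h0])
    · right
      rw [hcompat _ h0]
      by_contra hlt
      exact hcon ⟨h0, by omega⟩
  have h2inv : ValGE νE 0 (2 : E)⁻¹ := Or.inr (by rw [hE.map_inv hoddE.1, hoddE.2]; simp)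
  have h2F : (2 : F) ≠ 0 := hodd.1
  set T : F := 2⁻¹ * (2⁻¹ * Algebra.trace F E y) with hTdef
  have hT' : ValGE νE (νE y + 1) (algebraMap F E T) := by
    have := hE.valGE_mul h2inv (hE.valGE_mul h2inv hT)
    simpa only [hTdef, map_mul, map_inv₀, map_ofNat, zero_add] using this
  set z : E := y - algebraMap F E T with hz
  have hratio : ValGE νE 1 (z * y⁻¹ - 1) := by
    have h1 := hE.valGE_neg (hE.valGE_mul hT' (Or.inr (hE.map_inv hy).ge : ValGE νE _ y⁻¹))
    have h3 : z * y⁻¹ - 1 = -(algebraMap F E T * y⁻¹) := by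
      rw [hz]
      field_simp
      ring
    rw [h3]
    exact valGE_mono h1 (by omega)
  have hz0 : z ≠ 0 := by
    intro h0
    exact hE.ne_zero_of_valGE_sub_one hratio (by rw [h0, zero_mul])
  have hσz : σ z = z := by rw [hz, map_sub, hσy, AlgEquiv.commutes]
  have htr : Algebra.trace F E z = 0 := by
    rw [hz, map_sub, Algebra.trace_algebraMap, hdim, hTdef]
    simp only [nsmul_eq_mul]
    field_simp
    norm_num
  obtain ⟨s, hs0, hs⟩ := exists_mul_algEquiv_eq_of_valGE_sub_one hF hE heEF hcompat hodd σ
    (by rw [map_mul, map_inv₀, hσz, hσy]) hratio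
  refine hcoset z hz0 hσz htr ⟨s⁻¹, inv_ne_zero hs0, ?_⟩
  rw [map_inv₀, ← mul_inv, hs, mul_inv, inv_inv, mul_comm]

end Extension

section Form

variable {F E : Type*} [Field F] [Field E] [Algebra F E]

/-- The bilinear form `(x, y) ↦ tr (δ * x * σ y)`. -/
noncomputable def twistedTraceForm (σ : E ≃ₐ[F] E) (δ : E) : LinearMap.BilinForm F E :=
  LinearMap.mk₂ F (fun x y => Algebra.trace F E (δ * x * σ y))
    (fun x x' y => by rw [← map_add]; ring_nf)
    (fun c x y => by rw [← map_smul]; simp)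
    (fun x y y' => by rw [← map_add, map_add σ]; ring_nf)
    (fun c x y => by rw [← map_smul]; simp)

lemma twistedTraceForm_apply (σ : E ≃ₐ[F] E) (δ x y : E) :
    twistedTraceForm σ δ x y = Algebra.trace F E (δ * x * σ y) := rfl

lemma twistedTraceForm_neg_swap {σ : E ≃ₐ[F] E} (hσ2 : ∀ x, σ (σ x) = x) {δ : E}
    (hδ : σ δ = -δ) (x y : E) : twistedTraceForm σ δ x y = -twistedTraceForm σ δ y x := by
  rw [twistedTraceForm_apply, twistedTraceForm_apply,
    ← Algebra.trace_eq_of_algEquiv σ (δ * x * σ y), ← map_neg]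
  simp only [map_mul, hδ, hσ2]
  ring_nf

lemma twistedTraceForm_self {σ : E ≃ₐ[F] E} (hσ2 : ∀ x, σ (σ x) = x) {δ : E}
    (hδ : σ δ = -δ) (h2 : (2 : F) ≠ 0) (x : E) : twistedTraceForm σ δ x x = 0 := by
  have := twistedTraceForm_neg_swap hσ2 hδ x x
  have h : 2 * twistedTraceForm σ δ x x = 0 := by linear_combination this
  exact (mul_eq_zero.mp h).resolve_left h2

lemma twistedTraceForm_mul_left {σ : E ≃ₐ[F] E} {δ β : E} (hβ : σ β = -β) (u : E) :
    twistedTraceForm σ δ u (β * u) = -Algebra.trace F E (β * δ * (u * σ u)) := by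
  rw [twistedTraceForm_apply, ← map_neg, map_mul σ, hβ]
  ring_nf

end Form

/-- For an alternating form `B`, the transvection `v ↦ v + c * B u v • u` is a bijective
isometry. -/
lemma transvection_isometry_bijective {F V : Type*} [Field F] [AddCommGroup V] [Module F V]
    (B : LinearMap.BilinForm F V) (hneg : ∀ v w, B v w = -B w v) (hself : ∀ v, B v v = 0)
    (c : F) (u : V) :
    (∀ v w, B (v + (c * B u v) • u) (w + (c * B u w) • u) = B v w) ∧
      Function.Bijective fun v => v + (c * B u v) • u := by
  refine ⟨fun v w => ?_, Function.bijective_iff_has_inverse.mpr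
    ⟨fun v => v + (-c * B u v) • u, fun v => ?_, fun v => ?_⟩⟩
  · simp only [map_add, map_smul, LinearMap.add_apply, LinearMap.smul_apply, smul_eq_mul, hself]
    rw [hneg v u]
    ring
  · simp only [map_add, map_smul, smul_eq_mul, hself, mul_zero, add_zero, neg_mul, neg_smul,
      add_neg_cancel_right]
  · simp only [map_add, map_smul, smul_eq_mul, hself, mul_zero, add_zero, neg_mul, neg_smul,
      map_neg, neg_zero, neg_add_cancel_right]

/-- The long root vector `t` attached to a symplectic basis is of the form
`v ↦ ε * B f v • f` with `ε = ± 1`. -/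
lemma exists_longRoot_eq_smulRight {F V : Type*} [Field F] [AddCommGroup V] [Module F V]
    (B : LinearMap.BilinForm F V) (hneg : ∀ v w, B v w = -B w v) (e : ℤ → V)
    (hspan : Submodule.span F {e (-2), e (-1), e 1, e 2} = ⊤)
    (hsymp : ∀ i ∈ ({1, 2} : Set ℤ), ∀ j ∈ ({1, 2} : Set ℤ),
      B (e (-i)) (e j) = (if i = j then 1 else 0) ∧
        B (e i) (e j) = 0 ∧ B (e (-i)) (e (-j)) = 0)
    {k : ℤ} (hk : k ∈ I4) (t : V →ₗ[F] V) (ht : t (e k) = e (-k))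
    (ht0 : ∀ s ∈ I4, s ≠ k → t (e s) = 0) :
    ∃ ε : F, ε ≠ 0 ∧ e (-k) ≠ 0 ∧ t = ε • (B (e (-k))).smulRight (e (-k)) := by
  have h11 := hsymp 1 (by simp) 1 (by simp)
  have h12 := hsymp 1 (by simp) 2 (by simp)
  have h21 := hsymp 2 (by simp) 1 (by simp)
  have h22 := hsymp 2 (by simp) 2 (by simp)
  norm_num at h11 h12 h21 h22
  have hp11 : B (e 1) (e (-1)) = -1 := by rw [hneg, h11.1]
  have hp12 : B (e 1) (e (-2)) = 0 := by rw [hneg, h21.1, neg_zero]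
  have hp21 : B (e 2) (e (-1)) = 0 := by rw [hneg, h12.1, neg_zero]
  have hp22 : B (e 2) (e (-2)) = -1 := by rw [hneg, h22.1]
  have hne (i j : ℤ) (hij : B (e i) (e j) ≠ 0) : e i ≠ 0 := by
    intro h0
    simp [h0] at hij
  have htm2 := ht0 (-2) (by simp [I4])
  have htm1 := ht0 (-1) (by simp [I4])
  have ht1 := ht0 1 (by simp [I4])
  have ht2 := ht0 2 (by simp [I4])
  have hk' : k = -2 ∨ k = -1 ∨ k = 1 ∨ k = 2 := hk
  rcases hk' with rfl | rfl | rfl | rfl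
  · norm_num at ht htm2 htm1 ht1 ht2 ⊢
    refine ⟨-1, by simp, hne 2 (-2) (by simp [hp22]), LinearMap.ext_on hspan ?_⟩
    clear hsymp hneg hne ht0 hspan
    rintro v (rfl | rfl | rfl | rfl) <;> simp [*]
  · norm_num at ht htm2 htm1 ht1 ht2 ⊢
    refine ⟨-1, by simp, hne 1 (-1) (by simp [hp11]), LinearMap.ext_on hspan ?_⟩
    clear hsymp hneg hne ht0 hspan
    rintro v (rfl | rfl | rfl | rfl) <;> simp [*]
  · norm_num at ht htm2 htm1 ht1 ht2 ⊢
    refine ⟨1, by simp, hne (-1) 1 (by simp [h11]), LinearMap.ext_on hspan ?_⟩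
    clear hsymp hneg hne ht0 hspan
    rintro v (rfl | rfl | rfl | rfl) <;> simp [*]
  · norm_num at ht htm2 htm1 ht1 ht2 ⊢
    refine ⟨1, by simp, hne (-2) 2 (by simp [h22]), LinearMap.ext_on hspan ?_⟩
    clear hsymp hneg hne ht0 hspan
    rintro v (rfl | rfl | rfl | rfl) <;> simp [*]

/-- Proposition 5.2.2.
Setup: `E/F` biquadratic generated by the skew element `β` with `n = −ν_E(β) ≥ 1`,
`V = E` with symplectic form `h(x,y) = tr_{E/F}(δ₀ x σ(y))`, coset condition
`β δ₀ z⁻¹ ∉ N_{E/E₀}(E^×)` for all `z ∈ E₀^×` with `tr_{E₀/F}(z) = 0`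
(realized via the `σ`-fixed elements and `N_{E/E₀}(w) = w·σ(w)`), the lattice
sequence `Λ(i) = 𝔭_E^i v₀` self-dual with invariant `d ∈ {0,1}`, a symplectic
basis `(e_{−2},e_{−1},e₁,e₂)` adapted to `Λ`, `k ∈ {−2,−1,1,2}` with long-root
generator `t_k`, and `g ∈ P(Λ)` with inverse `g'`.  Conclusion: `ψ_β` is
nontrivial on `g U_k g⁻¹ ∩ P_{⌊n/2⌋+1}(Λ)`: some element
`u = 1 + x·g t_k g⁻¹` of this intersection satisfies `ψ_β(u) ≠ 1`. -/
theorem psibeta_nontrivial_on_conjugate_intersection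
    {F E : Type*} [Field F] [Field E] [Algebra F E] [FiniteDimensional F E]
    (νF : F → ℤ) (νE : E → ℤ)
    (hF : IsNALocalField νF) (hE : IsNALocalField νE)
    (hodd : OddResidualChar νF)
    (hdim : Module.finrank F E = 4)
    (eEF : ℤ) (heEF : 0 < eEF)
    (hcompat : ∀ t : F, t ≠ 0 → νE (algebraMap F E t) = eEF * νF t)
    (ψ : F → ℂ) (hψadd : ∀ x y : F, ψ (x + y) = ψ x * ψ y) (hψ0 : ψ 0 = 1)
    (hψtriv : ∀ x : F, x ≠ 0 → 0 < νF x → ψ x = 1)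
    (hψnt : ∃ x : F, x ≠ 0 ∧ 0 ≤ νF x ∧ ψ x ≠ 1)
    (σ : E ≃ₐ[F] E) (hσ2 : ∀ x : E, σ (σ x) = x)
    (hσne : σ ≠ (AlgEquiv.refl : E ≃ₐ[F] E))
    (β : E) (hβskew : σ β = -β) (hβgen : Algebra.adjoin F {β} = ⊤)
    (δ₀ : E) (hδ₀ : δ₀ ≠ 0) (hδ₀skew : σ δ₀ = -δ₀)
    (hbiq : IsBiquadratic F E)
    (hcoset : ∀ z : E, z ≠ 0 → σ z = z → Algebra.trace F E z = 0 →
      ¬∃ w : E, w ≠ 0 ∧ β * δ₀ * z⁻¹ = w * σ w)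
    (h : E → E → F) (hh : ∀ x y : E, h x y = Algebra.trace F E (δ₀ * x * σ y))
    (v₀ : E) (hv₀ : v₀ ≠ 0)
    (Λ : ℤ → Set E) (hΛ : ∀ i : ℤ, Λ i = {x : E | x = 0 ∨ i + νE v₀ ≤ νE x})
    (d : ℤ) (hd : d = 0 ∨ d = 1)
    (hdual : ∀ i : ℤ,
      {v : E | ∀ w ∈ Λ i, h v w = 0 ∨ 1 ≤ νF (h v w)} = Λ (d - i))
    (n : ℤ) (hn : n = -νE β) (hn1 : 1 ≤ n)
    (e : ℤ → E)
    (hspan : Submodule.span F {e (-2), e (-1), e 1, e 2} = ⊤)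
    (hsymp : ∀ i ∈ ({1, 2} : Set ℤ), ∀ j ∈ ({1, 2} : Set ℤ),
      h (e (-i)) (e j) = (if i = j then 1 else 0) ∧
        h (e i) (e j) = 0 ∧ h (e (-i)) (e (-j)) = 0)
    (α : ℤ → ℤ → ℤ) (hα : ∀ s ∈ I4, Monotone (α s))
    (hadapt : ∀ j : ℤ, Λ j = {x : E | ∃ c : ℤ → F,
      x = c (-2) • e (-2) + c (-1) • e (-1) + c 1 • e 1 + c 2 • e 2 ∧
      ∀ s ∈ I4, c s = 0 ∨ α s j ≤ νF (c s)})
    (k : ℤ) (hk : k ∈ I4)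
    (t : E →ₗ[F] E) (ht : t (e k) = e (-k))
    (ht0 : ∀ s ∈ I4, s ≠ k → t (e s) = 0)
    (g g' : E →ₗ[F] E)
    (hgg' : g ∘ₗ g' = LinearMap.id) (hg'g : g' ∘ₗ g = LinearMap.id)
    (hgsymp : ∀ v w : E, h (g v) (g w) = h v w)
    (hgΛ : ∀ i : ℤ, g '' Λ i = Λ i) :
    ∃ x : F,
      (∀ j : ℤ, ∀ w ∈ Λ j,
        (LinearMap.id + x • (g ∘ₗ t ∘ₗ g') : E →ₗ[F] E) w - w ∈
          Λ (j + (n / 2 + 1))) ∧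
      (∀ v w : E,
        h ((LinearMap.id + x • (g ∘ₗ t ∘ₗ g') : E →ₗ[F] E) v)
            ((LinearMap.id + x • (g ∘ₗ t ∘ₗ g') : E →ₗ[F] E) w) = h v w) ∧
      Function.Bijective
        ((LinearMap.id + x • (g ∘ₗ t ∘ₗ g') : E →ₗ[F] E)) ∧
      ψ (LinearMap.trace F E
          (LinearMap.mulLeft F β ∘ₗ (x • (g ∘ₗ t ∘ₗ g')))) ≠ 1 := by
  have : IsGalois F E := hbiq.1
  obtain rfl : h = fun x y => twistedTraceForm σ δ₀ x y := by
    funext x y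
    exact hh x y
  have hneg := twistedTraceForm_neg_swap (F := F) hσ2 hδ₀skew
  have hself := twistedTraceForm_self (F := F) hσ2 hδ₀skew hodd.1
  have hβ : β ≠ 0 := by
    rintro rfl
    rw [Algebra.adjoin_singleton_zero, Subalgebra.bot_eq_top_iff_finrank_eq_one] at hβgen
    omega
  obtain ⟨ε, hε, hf, rfl⟩ := exists_longRoot_eq_smulRight _ hneg e hspan hsymp hk t ht ht0
  have hg'g_apply (v : E) : g' (g v) = v := LinearMap.congr_fun hg'g v
  have hgg'_apply (v : E) : g (g' v) = v := LinearMap.congr_fun hgg' v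
  set u : E := g (e (-k)) with hu_def
  have hu : u ≠ 0 := by
    intro h0
    apply hf
    rw [← hg'g_apply (e (-k)), ← hu_def, h0, map_zero]
  have hσu : σ u ≠ 0 := by simpa using hu
  have hconj : g ∘ₗ (ε • (twistedTraceForm σ δ₀ (e (-k))).smulRight (e (-k))) ∘ₗ g'
      = ε • (twistedTraceForm σ δ₀ u).smulRight u := by
    ext v
    have h1 := hgsymp (e (-k)) (g' v)
    simp only [hgg'_apply] at h1
    simp [← h1, hu_def]
  rw [hconj]
  set y : E := β * δ₀ * (u * σ u) with hy_def
  have hy : y ≠ 0 := by positivity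
  have hσy : σ y = y := by
    simp only [hy_def, map_mul, hβskew, hδ₀skew, hσ2]
    ring
  obtain ⟨htr, hval⟩ := trace_ne_zero_and_val_le hF hE heEF hcompat hodd hdim σ hy hσy <| by
    rintro z hz hσz htrz ⟨w, hw, hyw⟩
    refine hcoset z hz hσz htrz ⟨w * u⁻¹, mul_ne_zero hw (inv_ne_zero hu), ?_⟩
    rw [map_mul, map_inv₀]
    field_simp
    rw [hy_def] at hyw
    field_simp at hyw
    linear_combination hyw
  set T : F := Algebra.trace F E y with hT
  obtain ⟨x₀, hx₀, hx₀v, hx₀ψ⟩ := hψnt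
  set q : F := -(x₀ * T⁻¹) with hq_def
  have hq : q ≠ 0 := by simp [hq_def, hx₀, htr]
  have hx (v : E) : ((ε⁻¹ * q) • ε • (twistedTraceForm σ δ₀ u).smulRight u : E →ₗ[F] E) v
      = (q * twistedTraceForm σ δ₀ u v) • u := by
    simp only [LinearMap.smul_apply, LinearMap.smulRight_apply, smul_smul]
    congr 1
    field_simp
  obtain ⟨hiso, hbij⟩ := transvection_isometry_bijective _ hneg hself q u
  refine ⟨ε⁻¹ * q, fun j w hw => ?_, fun v w => ?_, ?_, ?_⟩
  · rw [LinearMap.add_apply, LinearMap.id_apply, add_sub_cancel_left, hx, hΛ]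
    rw [hΛ] at hw
    have hqv : ValGE νE (-νE y) (algebraMap F E q) := by
      right
      have h1 : νF q = νF x₀ - νF T := by
        have h2 : q = -1 * (x₀ * T⁻¹) := by ring
        have hxT := mul_ne_zero hx₀ (inv_ne_zero htr)
        rw [h2, hF.map_mul _ _ (by simp) hxT, hF.map_neg_one,
          hF.map_mul _ _ hx₀ (inv_ne_zero htr), hF.map_inv htr]
        ring
      rw [hcompat q hq, h1]
      nlinarith
    have hδuw : ValGE νE (νE δ₀ + νE u + (j + νE v₀)) (δ₀ * u * σ w) :=
      hE.valGE_mul (hE.valGE_mul (Or.inr le_rfl) (Or.inr le_rfl))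
        (valGE_algEquiv hF hE heEF hcompat hodd σ hw)
    have hval_y : νE y = νE β + νE δ₀ + (νE u + νE u) := by
      rw [hy_def, hE.map_mul _ _ (mul_ne_zero hβ hδ₀) (mul_ne_zero hu hσu),
        hE.map_mul _ _ hβ hδ₀, hE.map_mul _ _ hu hσu,
        val_algEquiv hF hE heEF hcompat hodd σ hu]
    have hmain := hE.valGE_mul (hE.valGE_mul hqv
      (valGE_trace hF hE heEF hcompat hodd hδuw)) (Or.inr le_rfl : ValGE νE (νE u) u)
    rw [← map_mul, ← Algebra.smul_def] at hmain
    exact IsNALocalField.valGE_mono hmain (by omega)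
  · simpa only [LinearMap.add_apply, LinearMap.id_apply, hx] using hiso v w
  · convert hbij using 1
    funext v
    simp only [LinearMap.add_apply, LinearMap.id_apply, hx]
  · have hcomp : LinearMap.mulLeft F β ∘ₗ
        ((ε⁻¹ * q) • ε • (twistedTraceForm σ δ₀ u).smulRight u)
        = q • (twistedTraceForm σ δ₀ u).smulRight (β * u) := by
      ext v
      rw [LinearMap.comp_apply, hx]
      simp [smul_smul]
    rw [hcomp, map_smul, LinearMap.trace_smulRight, twistedTraceForm_mul_left hβskew, ← hy_def,
      ← hT, hq_def, smul_eq_mul, neg_mul_neg, mul_assoc, inv_mul_cancel₀ htr, mul_one]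
    exact hx₀ψ
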